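/- Wronskian determinant formula (Lemma 2.1, tensor part): Let d₀ ≥ 1 and let W(s) := P(s) ⊗ Id_{d₀} be the Kronecker product of P(s) with the d₀ × d₀ identity matrix, a (κ+1)d₀ × (κ+1)d₀ real matrix. Then for every s > 0, det W(s) = ( ∏_{0 ≤ i < j ≤ κ} (α_i − α_j)^{d₀} / ∏_{i=0}^{κ} ∏_{j=0}^{κ} (1 + i + α_j)^{d₀} ) · s^{d₀ (κ+1)(κ+2)/2 + d₀ Σ_{i=0}^{κ} α_i}. -/

import Mathlib

open Finset Kronecker

open Polynomial in
theorem auxQ (κ : ℕ) (α : Fin (κ + 1) → ℝ) :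
    (Matrix.of fun i j : Fin (κ + 1) =>
      ∏ k ∈ Finset.Ico ((i : ℕ) + 1) (κ + 1), ((1 : ℝ) + (k : ℝ) + α j)).det
      = ∏ i : Fin (κ + 1), ∏ j ∈ Finset.Ioi i, (α i - α j) := by
  let p : Fin (κ + 1) → ℝ[X] := fun i =>
    ∏ k ∈ Finset.Ico (((Fin.rev i : Fin (κ + 1)) : ℕ) + 1) (κ + 1), (X + C ((1 : ℝ) + (k : ℝ)))
  have hm : ∀ i, (p i).Monic := fun i => monic_prod_of_monic _ _ (fun k _ => monic_X_add_C _)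
  have hdeg : ∀ i, (p i).natDegree = i := by
    intro i
    have : (p i).natDegree = _ := natDegree_prod_of_monic _ _ (fun k _ => monic_X_add_C _)
    rw [this]
    simp only [natDegree_X_add_C, Finset.sum_const, Nat.card_Ico, Fin.val_rev]
    simp
    omega
  have h := Matrix.det_eval_matrixOfPolynomials_eq_det_vandermonde
    (fun j => α (Fin.rev j)) p hdeg hm
  rw [Matrix.det_vandermonde, ← Matrix.det_transpose] at h
  rw [← Matrix.det_submatrix_equiv_self (Fin.revPerm : Equiv.Perm (Fin (κ + 1)))]
  trans (∏ i : Fin (κ + 1), ∏ j ∈ Finset.Ioi i, (α (Fin.rev j) - α (Fin.rev i)))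
  · rw [h]
    congr 1
    ext i j
    simp [p, eval_prod, add_comm]
  · rw [Finset.prod_comm' (t' := Finset.univ) (s' := fun j => Finset.Iio j) (by simp)]
    rw [← Equiv.prod_comp (Fin.revPerm : Equiv.Perm (Fin (κ + 1)))]
    refine Finset.prod_congr rfl fun i _ => ?_
    refine Finset.prod_bij' (fun j _ => Fin.rev j) (fun j _ => Fin.rev j) ?_ ?_ ?_ ?_ ?_
    · intro j hj
      simp only [Finset.mem_Iio, Fin.revPerm_apply, Finset.mem_Ioi] at *
      exact Fin.lt_rev_iff.mp hj
    · intro j hj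
      simp only [Finset.mem_Iio, Fin.revPerm_apply, Finset.mem_Ioi] at *
      exact Fin.rev_lt_rev.mpr hj
    · simp
    · simp
    · simp

theorem auxP (κ : ℕ) (α : Fin (κ + 1) → ℝ)
    (hα : ∀ i, α i ∈ Set.Ioo (-1 : ℝ) 0) (s : ℝ) (hs : 0 < s) :
    (Matrix.of fun i j : Fin (κ + 1) =>
          s ^ ((1 : ℝ) + α j + (i : ℕ)) /
            ∏ k ∈ Finset.range ((i : ℕ) + 1), ((1 : ℝ) + (k : ℝ) + α j)).det
      = ((∏ i : Fin (κ + 1), ∏ j ∈ Finset.Ioi i, (α i - α j)) /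
            ∏ i : Fin (κ + 1), ∏ j : Fin (κ + 1), ((1 : ℝ) + (i : ℕ) + α j)) *
          s ^ ((((κ : ℝ) + 1) * ((κ : ℝ) + 2)) / 2 + ∑ i, α i) := by
  have hpos : ∀ (k : ℕ) j, (1 : ℝ) + (k : ℝ) + α j ≠ 0 := by
    intro k j
    have := (hα j).1
    have : (0 : ℝ) ≤ k := k.cast_nonneg
    have : 0 < (1 : ℝ) + (k : ℝ) + α j := by linarith
    exact this.ne'
  have hM : (Matrix.of fun i j : Fin (κ + 1) =>
          s ^ ((1 : ℝ) + α j + (i : ℕ)) /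
            ∏ k ∈ Finset.range ((i : ℕ) + 1), ((1 : ℝ) + (k : ℝ) + α j))
      = Matrix.of fun i j : Fin (κ + 1) => (s ^ (((i : ℕ) : ℝ))) *
          (Matrix.of fun i j : Fin (κ + 1) =>
            (s ^ (1 + α j) / ∏ k ∈ Finset.range (κ + 1), ((1 : ℝ) + (k : ℝ) + α j)) *
            (Matrix.of fun i j : Fin (κ + 1) =>
      ∏ k ∈ Finset.Ico ((i : ℕ) + 1) (κ + 1), ((1 : ℝ) + (k : ℝ) + α j)) i j) i j := by
    ext i j
    simp only [Matrix.of_apply]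
    rw [← Finset.prod_range_mul_prod_Ico (fun k : ℕ => (1 : ℝ) + (k : ℝ) + α j)
      (show (i : ℕ) + 1 ≤ κ + 1 by omega), Real.rpow_add hs]
    have h1 : ∏ k ∈ Finset.range ((i : ℕ) + 1), ((1 : ℝ) + (k : ℝ) + α j) ≠ 0 :=
      Finset.prod_ne_zero_iff.mpr fun k _ => hpos k j
    have h2 : ∏ k ∈ Finset.Ico ((i : ℕ) + 1) (κ + 1), ((1 : ℝ) + (k : ℝ) + α j) ≠ 0 :=
      Finset.prod_ne_zero_iff.mpr fun k _ => hpos k j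
    field_simp
  rw [hM, Matrix.det_mul_column, Matrix.det_mul_row, auxQ, Finset.prod_div_distrib]
  have hD : ∏ j : Fin (κ + 1), ∏ k ∈ Finset.range (κ + 1), ((1 : ℝ) + (k : ℝ) + α j)
      = ∏ i : Fin (κ + 1), ∏ j : Fin (κ + 1), ((1 : ℝ) + (i : ℕ) + α j) := by
    rw [Finset.prod_comm]
    exact Finset.prod_range (fun k : ℕ => ∏ j, ((1 : ℝ) + (k : ℝ) + α j))
  have hsum : (∑ i : Fin (κ + 1), ((i : ℕ) : ℝ)) = (κ : ℝ) * (κ + 1) / 2 := by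
    rw [← Finset.sum_range (fun k : ℕ => (k : ℝ))]
    clear * -
    induction κ with
    | zero => simp
    | succ n ih => rw [Finset.sum_range_succ, ih]; push_cast; ring
  have hS : (∏ i : Fin (κ + 1), s ^ (((i : ℕ) : ℝ))) * ∏ j, s ^ (1 + α j)
      = s ^ ((((κ : ℝ) + 1) * ((κ : ℝ) + 2)) / 2 + ∑ i, α i) := by
    rw [← Real.rpow_sum_of_pos hs, ← Real.rpow_sum_of_pos hs, ← Real.rpow_add hs, hsum,
      Finset.sum_add_distrib]
    congr 1
    simp
    ring
  rw [hD, ← hS]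
  ring

/-- **Wronskian determinant formula (Lemma 2.1, tensor part).**
With `P(s)` as in the scalar part and `W(s) = P(s) ⊗ Id_{d₀}` the Kronecker
product with the `d₀ × d₀` identity matrix, one has
`det W(s) = (∏_{i<j}(α_i−α_j)^{d₀} / ∏_{i,j}(1+i+α_j)^{d₀}) · s^{d₀(κ+1)(κ+2)/2 + d₀ Σ α_i}`. -/
theorem det_wronskian_tensor (κ : ℕ) (α : Fin (κ + 1) → ℝ)
    (hα : ∀ i, α i ∈ Set.Ioo (-1 : ℝ) 0) (d₀ : ℕ) (hd₀ : 1 ≤ d₀)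
    (s : ℝ) (hs : 0 < s) :
    ((Matrix.of fun i j : Fin (κ + 1) =>
          s ^ ((1 : ℝ) + α j + (i : ℕ)) /
            ∏ k ∈ Finset.range ((i : ℕ) + 1), ((1 : ℝ) + (k : ℝ) + α j)) ⊗ₖ
        (1 : Matrix (Fin d₀) (Fin d₀) ℝ)).det
      = ((∏ i : Fin (κ + 1), ∏ j ∈ Finset.Ioi i, (α i - α j) ^ d₀) /
            ∏ i : Fin (κ + 1), ∏ j : Fin (κ + 1), ((1 : ℝ) + (i : ℕ) + α j) ^ d₀) *
          s ^ ((d₀ : ℝ) * (((κ : ℝ) + 1) * ((κ : ℝ) + 2)) / 2 + (d₀ : ℝ) * ∑ i, α i) := by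
  rw [Matrix.det_kronecker, auxP κ α hα s hs]
  simp only [Matrix.det_one, one_pow, mul_one, Fintype.card_fin, Finset.prod_pow]
  rw [mul_pow, div_pow, ← Real.rpow_mul_natCast hs.le]
  congr 2
  ring
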